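/- Let p > 2 be a real number, n ≥ 1 an integer, ε > 0, and let f : ℝ → ℝ be continuous. Set β = p/(2(p−1)), a = β^p, and A = β^{p−1}(β−1) + ((n−1)/(p−1))·β^{p−1}. Suppose u : ℝ → ℝ is twice differentiable on (0, ε) with u'(r) ≠ 0 for all r ∈ (0, ε), and satisfies u''(r) + ((n−1)/((p−1) r)) u'(r) + f(u(r)) / ((p−1)·|u'(r)|^{p−2}) = 0 for all r ∈ (0, ε). Then the function w defined by w(z) := u(z^{1/β}) satisfies a·w''(z) + (A/z)·w'(z) + z^{p−2} f(w(z)) / ((p−1)·|w'(z)|^{p−2}) = 0 for all z ∈ (0, ε^β). -/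

import Mathlib

open Set

/-- The regularizing transformation `z = r^(p/(2(p-1)))`: with `β = p/(2(p-1))`,
`a = β^p`, `A = β^(p-1)(β-1) + ((n-1)/(p-1))β^(p-1)`, the function `w(z) = u(z^(1/β))`
satisfies `a w'' + (A/z) w' + z^(p-2) f(w)/((p-1)|w'|^(p-2)) = 0`. -/
theorem stmt9 (p : ℝ) (hp : 2 < p) (n : ℕ) (hn : 1 ≤ n) (ε : ℝ) (hε : 0 < ε)
    (β a A : ℝ) (hβ : β = p / (2 * (p - 1))) (ha : a = β ^ p)
    (hA : A = β ^ (p - 1) * (β - 1) + ((n : ℝ) - 1) / (p - 1) * β ^ (p - 1))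
    (f : ℝ → ℝ) (hf : Continuous f) (u : ℝ → ℝ)
    (hu1 : ∀ r ∈ Ioo (0:ℝ) ε, DifferentiableAt ℝ u r)
    (hu2 : ∀ r ∈ Ioo (0:ℝ) ε, DifferentiableAt ℝ (deriv u) r)
    (hu' : ∀ r ∈ Ioo (0:ℝ) ε, deriv u r ≠ 0)
    (heq : ∀ r ∈ Ioo (0:ℝ) ε,
      deriv (deriv u) r + ((n : ℝ) - 1) / ((p - 1) * r) * deriv u r
        + f (u r) / ((p - 1) * |deriv u r| ^ (p - 2)) = 0)
    (w : ℝ → ℝ) (hw : w = fun z => u (z ^ (1 / β))) :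
    ∀ z ∈ Ioo (0:ℝ) (ε ^ β),
      a * deriv (deriv w) z + A / z * deriv w z
        + z ^ (p - 2) * f (w z) / ((p - 1) * |deriv w z| ^ (p - 2)) = 0 := by
  intro z hz
  have hz0 : 0 < z := hz.1
  have hp1 : 0 < p - 1 := by linarith
  have hβ0 : 0 < β := by rw [hβ]; positivity
  have hr : ∀ y ∈ Ioo (0:ℝ) (ε ^ β), y ^ (1 / β) ∈ Ioo (0:ℝ) ε := by
    intro y hy
    refine ⟨Real.rpow_pos_of_pos hy.1 _, ?_⟩
    calc y ^ (1 / β) < (ε ^ β) ^ (1 / β) :=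
          Real.rpow_lt_rpow hy.1.le hy.2 (by positivity)
      _ = ε := by
          rw [← Real.rpow_mul hε.le, mul_one_div_cancel hβ0.ne', Real.rpow_one]
  have hw1 : ∀ y ∈ Ioo (0:ℝ) (ε ^ β),
      deriv w y = deriv u (y ^ (1 / β)) * (1 / β * y ^ (1 / β - 1)) := by
    intro y hy
    rw [hw]
    exact ((hu1 _ (hr y hy)).hasDerivAt.comp y
      (Real.hasDerivAt_rpow_const (Or.inl hy.1.ne'))).deriv
  have hw2 : deriv (deriv w) z
      = deriv (deriv u) (z ^ (1 / β)) * (1 / β * z ^ (1 / β - 1)) * (1 / β * z ^ (1 / β - 1))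
        + deriv u (z ^ (1 / β)) * (1 / β * ((1 / β - 1) * z ^ (1 / β - 1 - 1))) := by
    have hev : deriv w =ᶠ[nhds z]
        fun y => deriv u (y ^ (1 / β)) * (1 / β * y ^ (1 / β - 1)) :=
      Filter.eventuallyEq_of_mem (isOpen_Ioo.mem_nhds hz) hw1
    rw [hev.deriv_eq]
    exact (((hu2 _ (hr z hz)).hasDerivAt.comp z
      (Real.hasDerivAt_rpow_const (Or.inl hz0.ne'))).mul
      ((Real.hasDerivAt_rpow_const (Or.inl hz0.ne')).const_mul (1 / β))).deriv
  have hwz : w z = u (z ^ (1 / β)) := by rw [hw]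
  have hE := heq _ (hr z hz)
  have hd := hu' _ (hr z hz)
  have hexp : (1 / β - 1) * (p - 2) + (1 / β - 1) * 2 = p - 2 := by
    rw [hβ]
    have : p ≠ 0 := by linarith
    field_simp
    ring
  have hpow : z ^ (p - 2) = (z ^ (1 / β - 1)) ^ (p - 2) * (z ^ (1 / β - 1)) ^ 2 := by
    rw [← Real.rpow_natCast (z ^ (1 / β - 1)) 2, ← Real.rpow_mul hz0.le, ← Real.rpow_mul hz0.le,
      ← Real.rpow_add hz0]
    rw [Nat.cast_ofNat, hexp]
  have hZ1 : z ^ (1 / β - 1) = z ^ (1 / β) / z := Real.rpow_sub_one hz0.ne' _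
  have hZ0 : 0 < z ^ (1 / β) := (hr z hz).1
  have habs : |deriv u (z ^ (1 / β)) * (1 / β * z ^ (1 / β - 1))| ^ (p - 2)
      = |deriv u (z ^ (1 / β))| ^ (p - 2) * ((z ^ (1 / β - 1)) ^ (p - 2) / β ^ (p - 2)) := by
    have hnn : 0 ≤ z ^ (1 / β - 1) := Real.rpow_nonneg hz0.le _
    rw [abs_mul, abs_of_nonneg (by positivity : 0 ≤ 1 / β * z ^ (1 / β - 1)),
      Real.mul_rpow (abs_nonneg _) (by positivity), one_div_mul_eq_div,
      Real.div_rpow hnn hβ0.le]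
  have haB : a = β ^ (p - 2) * β ^ 2 := by
    rw [ha, ← Real.rpow_natCast β 2, ← Real.rpow_add hβ0]
    norm_num
  have hB1 : β ^ (p - 1) = β ^ (p - 2) * β := by
    rw [← Real.rpow_add_one hβ0.ne']
    ring_nf
  have hU : 0 < |deriv u (z ^ (1 / β))| ^ (p - 2) := Real.rpow_pos_of_pos (abs_pos.mpr hd) _
  have hK : 0 < (z ^ (1 / β - 1)) ^ (p - 2) :=
    Real.rpow_pos_of_pos (Real.rpow_pos_of_pos hz0 _) _
  have hB : 0 < β ^ (p - 2) := Real.rpow_pos_of_pos hβ0 _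
  rw [hw2, hw1 z hz, hwz, habs, hpow, haB, hA, hB1, Real.rpow_sub_one hz0.ne' (1 / β - 1)]
  generalize (z ^ (1 / β - 1)) ^ (p - 2) = K at *
  rw [hZ1]
  generalize |deriv u (z ^ (1 / β))| ^ (p - 2) = U at *
  generalize deriv (deriv u) (z ^ (1 / β)) = d2 at *
  generalize deriv u (z ^ (1 / β)) = d1 at *
  generalize f (u (z ^ (1 / β))) = F at *
  generalize z ^ (1 / β) = Z at *
  generalize β ^ (p - 2) = B at *
  have hp1' := hp1.ne'
  trans B * (Z / z) ^ 2 * (d2 + ((n : ℝ) - 1) / ((p - 1) * Z) * d1 + F / ((p - 1) * U))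
  · clear hE
    field_simp
    ring
  · rw [hE, mul_zero]
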